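/- In the polynomial ring ℤ[x], the sequence of polynomials T_n(x) = (x+n)^n (n ≥ 0, with 0^0 = 1) is coefficientwise Hankel-totally positive: every minor of the infinite Hankel matrix ((x+n+n')^{n+n'})_{n,n'≥0} is a polynomial in x all of whose coefficients are nonnegative integers. -/

import Mathlib

open Finset Matrix

/-- The **Cauchy–Binet formula**. -/
theorem Matrix.det_mul_eq_sum_strictMono {R ι : Type*} [CommRing R] [LinearOrder ι] [Fintype ι]
    {k : ℕ} (A : Matrix (Fin k) ι R) (B : Matrix ι (Fin k) R) :
    (A * B).det = ∑ e : Fin k → ι with StrictMono e,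
      (A.submatrix id e).det * (B.submatrix e id).det := by
  have expand : (A * B).det = ∑ f : Fin k → ι, (∏ i, A i (f i)) * (B.submatrix f id).det := by
    have h := (detRowAlternating (R := R) (n := Fin k)).toMultilinearMap.map_sum
      (fun i l => A i l • B l)
    have hrow : (A * B) = fun i => ∑ l, A i l • B l := by
      ext i j
      simp [Matrix.mul_apply, Finset.sum_apply]
    rw [hrow]
    refine h.trans (Finset.sum_congr rfl fun f _ => ?_)
    exact (detRowAlternating (R := R) (n := Fin k)).toMultilinearMap.map_smul_univ
      (fun i => A i (f i)) (fun i => B (f i))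
  have restrict : (A * B).det = ∑ f : Fin k → ι with Function.Injective f,
      (∏ i, A i (f i)) * (B.submatrix f id).det := by
    rw [expand, Finset.sum_filter_of_ne]
    intro f _ hf
    by_contra hinj
    simp only [Function.Injective, not_forall] at hinj
    obtain ⟨a, b, hab, hne⟩ := hinj
    apply hf
    rw [det_zero_of_row_eq hne, mul_zero]
    ext j
    simp [hab]
  rw [restrict]
  symm
  calc ∑ e : Fin k → ι with StrictMono e, (A.submatrix id e).det * (B.submatrix e id).det
      = ∑ e : Fin k → ι with StrictMono e, ∑ σ : Equiv.Perm (Fin k),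
          (∏ i, A i (e (σ i))) * (B.submatrix (e ∘ σ) id).det := by
        refine Finset.sum_congr rfl fun e _ => ?_
        rw [← det_transpose (A.submatrix id e), det_apply', Finset.sum_mul]
        refine Finset.sum_congr rfl fun σ _ => ?_
        have h := det_permute σ (B.submatrix e id)
        rw [submatrix_submatrix] at h
        simp only [Function.id_comp] at h
        rw [h]
        simp only [transpose_apply, submatrix_apply, id]
        ring
    _ = _ := by
        rw [← Finset.sum_product']
        refine Finset.sum_bij (fun p _ => p.1 ∘ p.2) ?_ ?_ ?_ ?_
        · rintro ⟨e, σ⟩ h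
          simp only [Finset.mem_product, Finset.mem_filter, Finset.mem_univ, true_and,
            and_true] at h ⊢
          exact h.injective.comp σ.injective
        · rintro ⟨e, σ⟩ h ⟨e', σ'⟩ h' heq
          simp only [Finset.mem_product, Finset.mem_filter, Finset.mem_univ, true_and,
            and_true] at h h' heq
          have hr : Set.range e = Set.range e' := by
            rw [← σ.surjective.range_comp e, heq, σ'.surjective.range_comp]
          obtain rfl := (h.range_inj h').1 hr
          refine Prod.ext rfl (Equiv.ext fun i => h.injective (congrFun heq i))
        · intro f hf
          simp only [Finset.mem_filter, Finset.mem_univ, true_and] at hf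
          refine ⟨(f ∘ Tuple.sort f, (Tuple.sort f)⁻¹), ?_, ?_⟩
          · simp only [Finset.mem_product, Finset.mem_filter, Finset.mem_univ, true_and, and_true]
            exact (Tuple.monotone_sort f).strictMono_of_injective
              (hf.comp (Tuple.sort f).injective)
          · ext i
            simp
        · rintro ⟨e, σ⟩ _
          rfl

section TotallyPositive

variable {R : Type*} [CommRing R]

/-- An infinite matrix all of whose minors lie in the subsemiring `S` of "nonnegative" elements. -/
def TotallyPositive (S : Subsemiring R) (M : ℕ → ℕ → R) : Prop :=
  ∀ (k : ℕ) (r c : Fin k → ℕ), StrictMono r → StrictMono c →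
    (Matrix.of fun a b => M (r a) (c b)).det ∈ S

/-- The product of infinite matrices, with row `i` of the left factor supported in columns
below `i + d`. -/
def bandMul (d : ℕ) (A B : ℕ → ℕ → R) (i j : ℕ) : R :=
  ∑ l ∈ range (i + d), A i l * B l j

theorem bandMul_eq_sum {d N i : ℕ} {A : ℕ → ℕ → R} (hA : ∀ l, i + d ≤ l → A i l = 0)
    (hN : i + d ≤ N) (B : ℕ → ℕ → R) (j : ℕ) :
    bandMul d A B i j = ∑ l ∈ range N, A i l * B l j := by
  refine Finset.sum_subset (Finset.range_mono hN) fun l _ hl => ?_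
  rw [hA l (by simpa using hl), zero_mul]

theorem bandMul_assoc {d e : ℕ} {A B : ℕ → ℕ → R} (hB : ∀ i l, i + e ≤ l → B i l = 0)
    (C : ℕ → ℕ → R) (i j : ℕ) :
    bandMul d A (bandMul e B C) i j = bandMul (d + e) (bandMul d A B) C i j := by
  have h : ∀ l ∈ range (i + d), A i l * bandMul e B C l j =
      ∑ m ∈ range (i + (d + e)), A i l * (B l m * C m j) := by
    intro l hl
    rw [bandMul_eq_sum (hB l) (N := i + (d + e)) (by rw [mem_range] at hl; omega), mul_sum]
  rw [bandMul, sum_congr rfl h, sum_comm]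
  simp only [bandMul, sum_mul, mul_assoc]

namespace TotallyPositive

variable {S : Subsemiring R}

theorem bandMul {d : ℕ} {A B : ℕ → ℕ → R} (hA : TotallyPositive S A) (hB : TotallyPositive S B)
    (hd : ∀ i l, i + d ≤ l → A i l = 0) : TotallyPositive S (bandMul d A B) := by
  intro k r c hr hc
  obtain ⟨N, hN⟩ : ∃ N, ∀ a, r a + d ≤ N :=
    ⟨∑ a, (r a + d), fun a => Finset.single_le_sum (f := fun a => r a + d)
      (fun _ _ => Nat.zero_le _) (mem_univ a)⟩
  have h : (Matrix.of fun a b => _root_.bandMul d A B (r a) (c b)) =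
      (Matrix.of fun a (l : Fin N) => A (r a) l) * (Matrix.of fun (l : Fin N) b => B l (c b)) := by
    ext a b
    simp only [Matrix.mul_apply, Matrix.of_apply]
    rw [bandMul_eq_sum (hd (r a)) (hN a), Finset.sum_range]
  rw [h, det_mul_eq_sum_strictMono]
  refine S.sum_mem fun e he => ?_
  have he' : StrictMono fun a => (e a : ℕ) := (Finset.mem_filter.1 he).2
  exact S.mul_mem (hA k r _ hr he') (hB k _ c he' hc)

theorem zero : TotallyPositive S (0 : ℕ → ℕ → R) := by
  intro k r c _ _
  cases k with
  | zero => simp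
  | succ k =>
    rw [det_eq_zero_of_row_eq_zero 0 (by simp)]
    exact S.zero_mem

theorem transpose {M : ℕ → ℕ → R} (hM : TotallyPositive S M) :
    TotallyPositive S fun i j => M j i := by
  intro k r c hr hc
  rw [← det_transpose]
  exact hM k c r hc hr

/-- A minor whose first row vanishes off its first entry. -/
theorem det_mem_of_first_row {k : ℕ} {M : Matrix (Fin (k + 1)) (Fin (k + 1)) R}
    (h : ∀ b : Fin k, M 0 b.succ = 0) (h0 : M 0 0 ∈ S)
    (hM : (M.submatrix Fin.succ Fin.succ).det ∈ S) : M.det ∈ S := by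
  rw [det_succ_row_zero, Fin.sum_univ_succ]
  simp only [h, mul_zero, zero_mul, sum_const_zero, add_zero, Fin.val_zero, pow_zero, one_mul]
  exact S.mul_mem h0 hM

/-- A minor whose first column vanishes off its first entry. -/
theorem det_mem_of_first_col {k : ℕ} {M : Matrix (Fin (k + 1)) (Fin (k + 1)) R}
    (h : ∀ b : Fin k, M b.succ 0 = 0) (h0 : M 0 0 ∈ S)
    (hM : (M.submatrix Fin.succ Fin.succ).det ∈ S) : M.det ∈ S := by
  rw [← det_transpose]
  refine det_mem_of_first_row h h0 ?_
  rw [← det_transpose] at hM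
  exact hM

/-- Upper bidiagonal matrices with nonnegative entries are totally positive. -/
theorem of_bidiagonal {M : ℕ → ℕ → R} (hS : ∀ i j, M i j ∈ S)
    (hM : ∀ i j, j ≠ i → j ≠ i + 1 → M i j = 0) : TotallyPositive S M := by
  intro k
  induction k with
  | zero => intro r c _ _; simp
  | succ k ih =>
    intro r c hr hc
    have hsub := ih (r ∘ Fin.succ) (c ∘ Fin.succ) (hr.comp (Fin.strictMono_succ))
      (hc.comp (Fin.strictMono_succ))
    by_cases h : c 0 ≤ r 0
    · refine det_mem_of_first_col (fun b => ?_) (hS _ _) hsub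
      have := hr (Fin.succ_pos b)
      exact hM _ _ (by omega) (by omega)
    · refine det_mem_of_first_row (fun b => ?_) (hS _ _) hsub
      have := hc (Fin.succ_pos b)
      exact hM _ _ (by omega) (by omega)

/-- A lower-triangular matrix whose entries multiply along chains `j ≤ l ≤ i` is totally
positive. -/
theorem of_multiplicative {M : ℕ → ℕ → R} (hS : ∀ i j, M i j ∈ S)
    (hM : ∀ i j, i < j → M i j = 0) (hmul : ∀ i l j, j ≤ l → l ≤ i → M i j = M i l * M l j) :
    TotallyPositive S M := by
  intro k
  induction k with
  | zero => intro r c _ _; simp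
  | succ k ih =>
    intro r c hr hc
    by_cases h : ∃ b : Fin k, c b.succ ≤ r 0
    · obtain ⟨b, hb⟩ := h
      set A : Matrix (Fin (k + 1)) (Fin (k + 1)) R := Matrix.of fun a b => M (r a) (c b)
      have hcol : A = A.updateCol 0 (M (c b.succ) (c 0) • fun a => A a b.succ) := by
        ext a j
        rcases eq_or_ne j 0 with rfl | hj
        · have h1 : c 0 ≤ c b.succ := (hc (Fin.succ_pos b)).le
          have h2 : r 0 ≤ r a := hr.monotone (Fin.zero_le a)
          simp only [updateCol_self, Pi.smul_apply, smul_eq_mul, A, Matrix.of_apply]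
          rw [hmul _ _ _ h1 (hb.trans h2), mul_comm]
        · rw [updateCol_ne hj]
      rw [hcol, det_updateCol_smul, det_zero_of_column_eq (Fin.succ_ne_zero b).symm, mul_zero]
      · exact S.zero_mem
      · intro a
        rw [updateCol_self, updateCol_ne (Fin.succ_ne_zero b)]
    · push Not at h
      exact det_mem_of_first_row (fun b => hM _ _ (h b)) (hS _ _)
        (ih (r ∘ Fin.succ) (c ∘ Fin.succ) (hr.comp (Fin.strictMono_succ))
          (hc.comp (Fin.strictMono_succ)))

end TotallyPositive

/-- The matrix `M` with the row `(1, 0, 0, …)` put on top. -/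
def consRow (M : ℕ → ℕ → R) : ℕ → ℕ → R
  | 0, j => if j = 0 then 1 else 0
  | i + 1, j => M i j

/-- The matrix `M` with the column `(1, 0, 0, …)` put on the left. -/
def consCol (M : ℕ → ℕ → R) (i j : ℕ) : R := consRow (fun a b => M b a) j i

/-- The matrix `M` with a zero column put on the left. -/
def consZeroCol (M : ℕ → ℕ → R) (i : ℕ) : ℕ → R
  | 0 => 0
  | j + 1 => M i j

/-- The block-diagonal matrix with blocks `1` and `M`. -/
def border (M : ℕ → ℕ → R) : ℕ → ℕ → R := consRow (consZeroCol M)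

namespace TotallyPositive

variable {S : Subsemiring R}

theorem consRow {M : ℕ → ℕ → R} (hM : TotallyPositive S M) :
    TotallyPositive S (consRow M) := by
  have pos : ∀ (k : ℕ) (r c : Fin k → ℕ), StrictMono r → StrictMono c → (∀ a, r a ≠ 0) →
      (Matrix.of fun a b => _root_.consRow M (r a) (c b)).det ∈ S := by
    intro k r c hr hc h0
    choose r' hr' using fun a => Nat.exists_eq_succ_of_ne_zero (h0 a)
    obtain rfl : r = fun a => (r' a).succ := funext hr'
    exact hM k r' c (fun a b h => Nat.succ_lt_succ_iff.1 (hr h)) hc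
  intro k r c hr hc
  cases k with
  | zero => simp
  | succ k =>
    by_cases h : r 0 = 0
    · refine det_mem_of_first_row (fun b => ?_) ?_
        (pos k (r ∘ Fin.succ) (c ∘ Fin.succ) (hr.comp Fin.strictMono_succ)
          (hc.comp Fin.strictMono_succ) fun a => ?_)
      · have := hc (Fin.succ_pos b)
        simp only [Matrix.of_apply, h, _root_.consRow]
        exact if_neg (by omega)
      · simp only [Matrix.of_apply, h, _root_.consRow]
        split_ifs
        exacts [S.one_mem, S.zero_mem]
      · have := hr (Fin.succ_pos a)
        simp only [Function.comp_apply]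
        omega
    · refine pos _ r c hr hc fun a => ?_
      have := hr.monotone (Fin.zero_le a)
      omega

theorem consCol {M : ℕ → ℕ → R} (hM : TotallyPositive S M) :
    TotallyPositive S (consCol M) :=
  hM.transpose.consRow.transpose

theorem border {M : ℕ → ℕ → R} (hM : TotallyPositive S M) :
    TotallyPositive S (border M) := by
  apply TotallyPositive.consRow
  intro k r c hr hc
  by_cases h : ∃ b, c b = 0
  · obtain ⟨b, hb⟩ := h
    rw [det_eq_zero_of_column_eq_zero b fun a => by simp [hb, consZeroCol]]
    exact S.zero_mem
  · push Not at h
    choose c' hc' using fun a => Nat.exists_eq_succ_of_ne_zero (h a)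
    obtain rfl : c = fun a => (c' a).succ := funext hc'
    exact hM k r c' hr (fun a b h => Nat.succ_lt_succ_iff.1 (hc h))

/-- A lower-triangular matrix generated by rows from a totally positive production matrix is
totally positive. -/
theorem of_row_recurrence {A P : ℕ → ℕ → R} (hP : TotallyPositive S P)
    (h0 : ∀ j, A 0 j = if j = 0 then 1 else 0) (hA : ∀ i j, i < j → A i j = 0)
    (hrec : ∀ i j, A (i + 1) j = _root_.bandMul 1 A P i j) : TotallyPositive S A := by
  have trunc : ∀ N, TotallyPositive S fun i j => if i < N then A i j else 0 := by
    intro N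
    induction N with
    | zero =>
      have h : (fun i j => if i < 0 then A i j else 0) = (0 : ℕ → ℕ → R) := by
        ext; simp
      rw [h]
      exact zero
    | succ N ih =>
      have h := ih.border.bandMul (d := 1) hP.consRow (by
        rintro (_ | i) (_ | l) hl
        · omega
        · simp [_root_.border, _root_.consRow]
        · omega
        · simp [_root_.border, _root_.consRow, consZeroCol, hA i l (by omega)])
      convert h using 3 with i j
      cases i with
      | zero => simp [_root_.bandMul, _root_.border, _root_.consRow, h0]
      | succ i =>
        rw [_root_.bandMul, Finset.sum_range_succ']
        by_cases hi : i < N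
        · simp [_root_.border, _root_.consRow, consZeroCol, hrec, _root_.bandMul, hi]
        · simp [_root_.border, _root_.consRow, consZeroCol, hi]
  intro k r c hr hc
  convert trunc (∑ a, (r a + 1)) k r c hr hc using 5 with a b
  refine (if_pos ?_).symm
  exact Finset.single_le_sum (f := fun a => r a + 1) (fun _ _ => Nat.zero_le _) (mem_univ a)

/-- A matrix generated by columns from a totally positive lower-Hessenberg production matrix is
totally positive. -/
theorem of_col_recurrence {A P : ℕ → ℕ → R} (hP : TotallyPositive S P)
    (hd : ∀ i l, i + 2 ≤ l → P i l = 0) (h0 : ∀ i, A i 0 = if i = 0 then 1 else 0)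
    (hrec : ∀ i j, A i (j + 1) = _root_.bandMul 2 P (fun i _ => A i j) i j) :
    TotallyPositive S A := by
  have trunc : ∀ N, TotallyPositive S fun i j => if j < N then A i j else 0 := by
    intro N
    induction N with
    | zero =>
      have h : (fun i j => if j < 0 then A i j else 0) = (0 : ℕ → ℕ → R) := by
        ext; simp
      rw [h]
      exact zero
    | succ N ih =>
      have h := hP.consCol.bandMul (d := 3) ih.border (by
        rintro i (_ | l) hl
        · omega
        · simp [_root_.consCol, _root_.consRow, hd i l (by omega)])
      convert h using 3 with i j
      rw [_root_.bandMul, show i + 3 = (i + 2) + 1 from rfl, Finset.sum_range_succ']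
      cases j with
      | zero => simp [_root_.border, _root_.consCol, _root_.consRow, consZeroCol, h0]
      | succ j =>
        by_cases hj : j < N
        · simp [_root_.border, _root_.consCol, _root_.consRow, consZeroCol, hrec,
            _root_.bandMul, hj]
        · simp [_root_.border, _root_.consCol, _root_.consRow, consZeroCol, hj]
  intro k r c hr hc
  convert trunc (∑ a, (c a + 1)) k r c hr hc using 5 with a b
  refine (if_pos ?_).symm
  exact Finset.single_le_sum (f := fun a => c a + 1) (fun _ _ => Nat.zero_le _) (mem_univ b)

end TotallyPositive

/-- The iterated images `P ^ j e₀`, as the columns of a matrix. -/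
def columnIterate (P : ℕ → ℕ → R) (i : ℕ) : ℕ → R
  | 0 => if i = 0 then 1 else 0
  | j + 1 => ∑ l ∈ range (i + 2), P i l * columnIterate P l j

/-- The Hankel matrix of the zeroth column of `A` factors through the production matrix. -/
theorem bandMul_columnIterate {A P : ℕ → ℕ → R} (hA : ∀ i j, i < j → A i j = 0)
    (hd : ∀ i l, i + 2 ≤ l → P i l = 0) (hrec : ∀ i j, A (i + 1) j = bandMul 1 A P i j)
    (i j : ℕ) : bandMul 1 A (columnIterate P) i j = A (i + j) 0 := by
  induction j generalizing i with
  | zero =>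
    simp [bandMul, columnIterate]
  | succ j ih =>
    have h1 : bandMul 1 A (columnIterate P) i (j + 1) =
        bandMul 1 A (bandMul 2 P (columnIterate P)) i j := rfl
    rw [h1, bandMul_assoc hd, show i + (j + 1) = i + 1 + j by ring, ← ih (i + 1),
      bandMul_eq_sum (fun l hl => hA _ l hl) (N := i + (1 + 2)) (by omega)]
    simp only [hrec]
    rfl

theorem TotallyPositive.hankel {S : Subsemiring R} {A P : ℕ → ℕ → R} (hP : TotallyPositive S P)
    (hd : ∀ i l, i + 2 ≤ l → P i l = 0) (h0 : ∀ j, A 0 j = if j = 0 then 1 else 0)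
    (hA : ∀ i j, i < j → A i j = 0) (hrec : ∀ i j, A (i + 1) j = _root_.bandMul 1 A P i j) :
    TotallyPositive S fun i j => A (i + j) 0 := by
  have h := (hP.of_row_recurrence h0 hA hrec).bandMul (d := 1)
    (hP.of_col_recurrence (A := columnIterate P) hd (fun _ => rfl) fun _ _ => rfl)
    fun i l hl => hA i l hl
  convert h using 3 with i j
  exact (bandMul_columnIterate hA hd hrec i j).symm

/-- The upper bidiagonal matrix with `x` on the diagonal and `1` above it. -/
def bidiagonal (x : R) (i j : ℕ) : R := if j = i then x else if j = i + 1 then 1 else 0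

theorem TotallyPositive.bidiagonal {S : Subsemiring R} {x : R} (hx : x ∈ S) :
    TotallyPositive S (bidiagonal x) := by
  refine of_bidiagonal (fun i j => ?_) fun i j h1 h2 => by simp [_root_.bidiagonal, h1, h2]
  unfold _root_.bidiagonal
  split_ifs
  exacts [hx, S.one_mem, S.zero_mem]

theorem bandMul_bidiagonal_zero {A : ℕ → ℕ → R} (x : R) (d i : ℕ) :
    bandMul (d + 1) A (bidiagonal x) i 0 = A i 0 * x := by
  rw [bandMul, Finset.sum_eq_single 0]
  · simp [bidiagonal]
  · intro l _ hl
    simp [bidiagonal, hl.symm]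
  · simp

theorem bandMul_bidiagonal_succ {A : ℕ → ℕ → R} (x : R) {d i : ℕ} (hA : ∀ l, i + d ≤ l → A i l = 0)
    (j : ℕ) : bandMul d A (bidiagonal x) i (j + 1) = A i (j + 1) * x + A i j := by
  rw [bandMul_eq_sum hA (N := i + d + j + 2) (by omega)]
  have h : ∀ l, A i l * bidiagonal x l (j + 1) =
      (if l = j + 1 then A i l * x else 0) + if l = j then A i l else 0 := by
    intro l
    unfold bidiagonal
    by_cases h1 : l = j + 1
    · subst h1; simp
    · by_cases h2 : l = j
      · subst h2; simp
      · simp [h1, h2, Ne.symm h1, Ne.symm h2]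
  simp only [h, sum_add_distrib, sum_ite_eq', mem_range]
  rw [if_pos (by omega), if_pos (by omega)]

/-- The lower-triangular matrix of binomial coefficients. -/
def binomialMatrix (R : Type*) [CommRing R] (i j : ℕ) : R := (i.choose j : R)

theorem TotallyPositive.binomialMatrix (S : Subsemiring R) :
    TotallyPositive S (binomialMatrix R) := by
  refine (TotallyPositive.bidiagonal S.one_mem).of_row_recurrence ?_ ?_ ?_
  · rintro (_ | j) <;> simp [_root_.binomialMatrix]
  · intro i j h
    simp [_root_.binomialMatrix, Nat.choose_eq_zero_of_lt h]
  · rintro i (_ | j)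
    · rw [bandMul_bidiagonal_zero]
      simp [_root_.binomialMatrix]
    · rw [bandMul_bidiagonal_succ]
      · simp [_root_.binomialMatrix, Nat.choose_succ_succ, add_comm]
      · intro l hl
        simp [_root_.binomialMatrix, Nat.choose_eq_zero_of_lt (Nat.lt_of_succ_le hl)]

/-- The lower-triangular matrix with entries `i! / j!`. -/
def factorialRatio (R : Type*) [CommRing R] : ℕ → ℕ → R
  | 0, j => if j = 0 then 1 else 0
  | i + 1, j => (i + 1) * factorialRatio R i j + if j = i + 1 then 1 else 0

theorem factorialRatio_of_lt {i j : ℕ} (h : i < j) : factorialRatio R i j = 0 := by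
  induction i with
  | zero => simp [factorialRatio, h.ne']
  | succ i ih => simp [factorialRatio, h.ne', ih (by omega)]

theorem factorialRatio_self (i : ℕ) : factorialRatio R i i = 1 := by
  cases i with
  | zero => simp [factorialRatio]
  | succ i => simp [factorialRatio, factorialRatio_of_lt]

theorem TotallyPositive.factorialRatio (S : Subsemiring R) :
    TotallyPositive S (factorialRatio R) := by
  refine of_multiplicative (fun i j => ?_) (fun i j => factorialRatio_of_lt) fun i l j hj hl => ?_
  · induction i with
    | zero =>
      unfold _root_.factorialRatio
      split_ifs
      exacts [S.one_mem, S.zero_mem]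
    | succ i ih =>
      unfold _root_.factorialRatio
      refine S.add_mem (S.mul_mem (S.add_mem (natCast_mem S i) S.one_mem) ih) ?_
      split_ifs
      exacts [S.one_mem, S.zero_mem]
  · induction i, hl using Nat.le_induction with
    | base => rw [factorialRatio_self, one_mul]
    | succ i hi ih =>
      simp only [_root_.factorialRatio]
      rw [ih, if_neg (by omega), if_neg (by omega)]
      ring

/-- Summation by parts against `i! / j!`. -/
theorem sum_sub_mul_factorialRatio (f : ℕ → R) (N j : ℕ) :
    ∑ l ∈ range N, (f l - (l + 1) * f (l + 1)) * factorialRatio R l j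
      + f N * factorialRatio R N j = if j ≤ N then f j else 0 := by
  induction N with
  | zero =>
    rcases eq_or_ne j 0 with rfl | hj <;> simp [factorialRatio, *]
  | succ N ih =>
    have h : (if j ≤ N + 1 then f j else 0) =
        (if j ≤ N then f j else 0) + f (N + 1) * if j = N + 1 then 1 else 0 := by
      rcases lt_trichotomy j (N + 1) with h | rfl | h
      · simp [h.le, Nat.le_of_lt_succ h, h.ne]
      · simp
      · rw [if_neg (by omega), if_neg (by omega), if_neg (by omega)]; simp
    rw [h, ← ih, sum_range_succ, factorialRatio]
    ring

/-- The lower-triangular matrix with entries `C(i,j) (x+i)^(i-j)`. -/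
def treeMatrix (x : R) (i j : ℕ) : R := i.choose j * (x + i) ^ (i - j)

theorem treeMatrix_of_lt (x : R) {i j : ℕ} (h : i < j) : treeMatrix x i j = 0 := by
  simp [treeMatrix, Nat.choose_eq_zero_of_lt h]

theorem sum_choose_mul_pow_mul_choose (y : R) (n m : ℕ) :
    ∑ j ∈ range (n + 1), n.choose j * y ^ (n - j) * (j.choose m : R) =
      n.choose m * (y + 1) ^ (n - m) := by
  rcases lt_or_ge n m with h | h
  · rw [Nat.choose_eq_zero_of_lt h, sum_eq_zero]
    · simp
    · intro j hj
      rw [mem_range] at hj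
      simp [Nat.choose_eq_zero_of_lt (show j < m by omega)]
  · obtain ⟨p, rfl⟩ := Nat.exists_eq_add_of_le h
    rw [add_assoc, sum_range_add, sum_eq_zero, zero_add, Nat.add_sub_cancel_left, add_comm y,
      add_pow, mul_sum]
    · refine sum_congr rfl fun i hi => ?_
      rw [mem_range] at hi
      have hc := Nat.choose_mul (n := m + p) (k := m + i) (s := m) (by omega)
      rw [Nat.add_sub_cancel_left, Nat.add_sub_cancel_left] at hc
      rw [Nat.add_sub_add_left, one_pow, one_mul, mul_right_comm, ← Nat.cast_mul, hc]
      push_cast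
      ring
    · intro j hj
      rw [mem_range] at hj
      simp [Nat.choose_eq_zero_of_lt hj]

/-- The production matrix of `treeMatrix x`. -/
def treeProduction (x : R) : ℕ → ℕ → R :=
  bandMul 2 (bandMul 1 (binomialMatrix R) (bidiagonal x)) (factorialRatio R)

theorem bandMul_binomialMatrix_bidiagonal_of_le (x : R) {i l : ℕ} (h : i + 2 ≤ l) :
    bandMul 1 (binomialMatrix R) (bidiagonal x) i l = 0 := by
  refine sum_eq_zero fun m hm => ?_
  rw [mem_range] at hm
  rw [bidiagonal, if_neg (by omega), if_neg (by omega), mul_zero]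

theorem treeProduction_of_le (x : R) {i l : ℕ} (h : i + 2 ≤ l) : treeProduction x i l = 0 := by
  rw [treeProduction, bandMul]
  refine sum_eq_zero fun m hm => ?_
  rw [mem_range] at hm
  rw [factorialRatio_of_lt (by omega), mul_zero]

theorem TotallyPositive.treeProduction {S : Subsemiring R} {x : R} (hx : x ∈ S) :
    TotallyPositive S (treeProduction x) :=
  ((TotallyPositive.binomialMatrix S).bandMul (TotallyPositive.bidiagonal hx) fun i l h => by
    simp [_root_.binomialMatrix, Nat.choose_eq_zero_of_lt (Nat.lt_of_succ_le h)]).bandMul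
    (TotallyPositive.factorialRatio S) fun _ _ h => bandMul_binomialMatrix_bidiagonal_of_le x h

theorem treeMatrix_succ (x : R) (i j : ℕ) :
    treeMatrix x (i + 1) j = bandMul 1 (treeMatrix x) (treeProduction x) i j := by
  have hbin : ∀ m, bandMul 1 (treeMatrix x) (binomialMatrix R) i m =
      i.choose m * (x + i + 1) ^ (i - m) := fun m => sum_choose_mul_pow_mul_choose _ _ _
  have hbi : ∀ l, bandMul 1 (treeMatrix x) (bandMul 1 (binomialMatrix R) (bidiagonal x)) i l =
      treeMatrix x (i + 1) l - (l + 1) * treeMatrix x (i + 1) (l + 1) := by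
    intro l
    rw [bandMul_assoc fun i l h => by
      simp [binomialMatrix, Nat.choose_eq_zero_of_lt (Nat.lt_of_succ_le h)]]
    have hx : x = (x + i + 1) - (i + 1) := by ring
    have habs : ((l : R) + 1) * ((i + 1).choose (l + 1) : R) = (i + 1) * i.choose l := by
      have h := congrArg (Nat.cast : ℕ → R) (Nat.add_one_mul_choose_eq i l)
      push_cast at h
      rw [h, mul_comm]
    have hpow : (i.choose l : R) * (x + i + 1) ^ (i + 1 - l) =
        i.choose l * ((x + i + 1) ^ (i - l) * (x + i + 1)) := by
      rcases le_or_gt l i with h | h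
      · rw [Nat.succ_sub h, pow_succ]
      · simp [Nat.choose_eq_zero_of_lt h]
    have hsub : treeMatrix x (i + 1) (l + 1) * (l + 1) =
        (i + 1) * (i.choose l * (x + i + 1) ^ (i - l)) := by
      rw [treeMatrix, Nat.add_sub_add_right]
      push_cast
      linear_combination (x + (i + 1)) ^ (i - l) * habs
    cases l with
    | zero =>
      rw [bandMul_bidiagonal_zero, hbin, mul_comm _ (treeMatrix x (i + 1) _), hsub, treeMatrix]
      push_cast at hpow ⊢
      simp only [Nat.choose_zero_right] at hpow ⊢
      push_cast at hpow ⊢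
      linear_combination -hpow
    | succ l =>
      rw [bandMul_bidiagonal_succ, hbin, hbin, mul_comm _ (treeMatrix x (i + 1) _), hsub,
        treeMatrix, Nat.choose_succ_succ]
      · rw [Nat.add_sub_add_right] at hpow ⊢
        push_cast at hpow ⊢
        linear_combination -hpow
      · intro m hm
        rw [hbin, Nat.choose_eq_zero_of_lt (by omega)]
        simp
  rw [treeProduction, bandMul_assoc fun _ _ h => bandMul_binomialMatrix_bidiagonal_of_le x h,
    bandMul]
  simp only [hbi]
  have h := sum_sub_mul_factorialRatio (treeMatrix x (i + 1)) (i + (1 + 2)) j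
  rw [treeMatrix_of_lt x (show i + 1 < i + (1 + 2) by omega), zero_mul, add_zero] at h
  rw [h]
  split_ifs with hj
  · rfl
  · exact treeMatrix_of_lt x (by omega)

theorem TotallyPositive.hankel_add_pow {S : Subsemiring R} {x : R} (hx : x ∈ S) :
    TotallyPositive S fun i j => (x + ((i + j : ℕ) : R)) ^ (i + j) := by
  have h := (TotallyPositive.treeProduction hx).hankel (A := treeMatrix x)
    (fun _ _ h => treeProduction_of_le x h)
    (fun j => by cases j <;> simp [treeMatrix]) (fun _ _ h => treeMatrix_of_lt x h)
    (treeMatrix_succ x)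
  simpa [treeMatrix] using h

end TotallyPositive

/-- The integer polynomials with nonnegative coefficients. -/
def nonnegPolynomials : Subsemiring (Polynomial ℤ) where
  carrier := {p | ∀ i, 0 ≤ p.coeff i}
  mul_mem' hp hq i := by
    rw [Polynomial.coeff_mul]
    exact sum_nonneg fun a _ => mul_nonneg (hp _) (hq _)
  one_mem' i := by
    rw [Polynomial.coeff_one]
    split_ifs <;> simp
  add_mem' hp hq i := by
    rw [Polynomial.coeff_add]
    exact add_nonneg (hp i) (hq i)
  zero_mem' i := by simp

theorem X_mem_nonnegPolynomials : Polynomial.X ∈ nonnegPolynomials := by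
  intro i
  rw [Polynomial.coeff_X]
  split_ifs <;> simp

/-- in `ℤ[x]`, the sequence of polynomials `T_n(x) = (x+n)^n`
(with `0^0 = 1`) is coefficientwise Hankel-totally positive: every minor of
the infinite Hankel matrix `((x+n+n')^(n+n'))_{n,n' ≥ 0}` is a polynomial in
`x` all of whose coefficients are nonnegative. -/
theorem hankel_xPlusN_coefficientwise_totallyPositive :
    ∀ (k : ℕ) (rows cols : Fin k → ℕ), StrictMono rows → StrictMono cols →
      ∀ i : ℕ,
        0 ≤ ((Matrix.of fun a b =>
          (Polynomial.X + ((rows a + cols b : ℕ) : Polynomial ℤ))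
            ^ (rows a + cols b)).det).coeff i :=
  TotallyPositive.hankel_add_pow X_mem_nonnegPolynomials
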